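/- arXiv:1803.05943 — 2 statements merged into one kernel-verified Lean document; each statement's English description precedes it below -/
import Mathlib

section
/- Let u = (u_n)_{n≥0} be a real sequence with u_0 ≠ 0. Then L_u is a multiplier for the binomial convolution of Appell sequences: for all Appell sequences A and C, every n ≥ 0 and every real x, (L_u (A×C))_n(x) = ((L_u A) × C)_n(x) = (A × (L_u C))_n(x). -/
open Finset MeasureTheory

/-- The `k`-th forward difference of `f : ℝ → ℝ`:
`Δ^k f(x) = ∑_{j=0}^k C(k,j) (-1)^(k-j) f(x+j)`. -/
noncomputable def fdiff (k : ℕ) (f : ℝ → ℝ) (x : ℝ) : ℝ :=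
  ∑ j ∈ Finset.range (k + 1), (k.choose j : ℝ) * (-1 : ℝ) ^ (k - j) * f (x + j)

/-- The `k`-th forward difference of a real polynomial, as a polynomial;
its evaluation at `x` is `∑_{j=0}^k C(k,j) (-1)^(k-j) p(x+j)`. -/
noncomputable def fdiffP (k : ℕ) (p : Polynomial ℝ) : Polynomial ℝ :=
  ∑ j ∈ Finset.range (k + 1),
    ((k.choose j : ℝ) * (-1 : ℝ) ^ (k - j)) • p.comp (Polynomial.X + Polynomial.C (j : ℝ))

/-- An Appell sequence of real polynomials: `A 0` is a nonzero constant and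
`A n' = n • A (n-1)` for `n ≥ 1`. -/
def IsAppell (A : ℕ → Polynomial ℝ) : Prop :=
  (A 0).eval 0 ≠ 0 ∧ (∃ c : ℝ, A 0 = Polynomial.C c) ∧
    ∀ n : ℕ, (A (n + 1)).derivative = ((n : ℝ) + 1) • A n

/-- The forward difference transformation `L_u A`, with
`(L_u A)_n(x) = ∑_{k=0}^n (u_k/k!) Δ^k A_n(x)`. -/
noncomputable def LP (u : ℕ → ℝ) (A : ℕ → Polynomial ℝ) (n : ℕ) : Polynomial ℝ :=
  ∑ k ∈ Finset.range (n + 1), (u k / (k.factorial : ℝ)) • fdiffP k (A n)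

/-- Binomial convolution of real sequences. -/
noncomputable def bconv (u v : ℕ → ℝ) (n : ℕ) : ℝ :=
  ∑ k ∈ Finset.range (n + 1), (n.choose k : ℝ) * u k * v (n - k)

/-- Binomial convolution of Appell sequences:
`(A×C)_n(x) = ∑_{k=0}^n C(n,k) A_k(0) C_{n-k}(x)`. -/
noncomputable def aconv (A C : ℕ → Polynomial ℝ) (n : ℕ) : Polynomial ℝ :=
  ∑ k ∈ Finset.range (n + 1), ((n.choose k : ℝ) * (A k).eval 0) • C (n - k)

/-- Stirling numbers of the second kind (real-valued):
`S(n,k) = (1/k!) ∑_{j=0}^k (-1)^(k-j) C(k,j) j^n`. -/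
noncomputable def stirling2 (n k : ℕ) : ℝ :=
  (1 / (k.factorial : ℝ)) *
    ∑ j ∈ Finset.range (k + 1), (-1 : ℝ) ^ (k - j) * (k.choose j : ℝ) * (j : ℝ) ^ n

/-- Signed Stirling numbers of the first kind: the coefficient of `x^k` in
`x(x-1)⋯(x-n+1)`. -/
noncomputable def stirling1 (n k : ℕ) : ℝ :=
  (∏ i ∈ Finset.range n, (Polynomial.X - Polynomial.C (i : ℝ))).coeff k

/-- Generalized binomial coefficient `C(y,k) = y(y-1)⋯(y-k+1)/k!`. -/
noncomputable def rchoose (y : ℝ) (k : ℕ) : ℝ :=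
  (∏ i ∈ Finset.range k, (y - i)) / (k.factorial : ℝ)

/-- Apostol-Euler polynomials `E_n(β;x) = ∑_{k=0}^n (-β)^k Δ^k I_n(x)`. -/
noncomputable def apostolEuler (β : ℝ) (n : ℕ) (x : ℝ) : ℝ :=
  ∑ k ∈ Finset.range (n + 1), (-β) ^ k * fdiff k (fun y => y ^ n) x

/-- Harmonic numbers `H_j = ∑_{i=1}^j 1/i`. -/
noncomputable def harm (j : ℕ) : ℝ := ∑ i ∈ Finset.range j, (1 : ℝ) / (i + 1)

/-- An Appell sequence without the normalization that its constant term is nonzero. -/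
def IsWeakAppell (A : ℕ → Polynomial ℝ) : Prop :=
  (A 0).derivative = 0 ∧ ∀ n : ℕ, (A (n + 1)).derivative = ((n : ℝ) + 1) • A n

theorem IsAppell.isWeakAppell {A : ℕ → Polynomial ℝ} (hA : IsAppell A) : IsWeakAppell A := by
  obtain ⟨-, ⟨c, hc⟩, h⟩ := hA
  exact ⟨by simp [hc], h⟩

theorem IsWeakAppell.natDegree_le {A : ℕ → Polynomial ℝ} (hA : IsWeakAppell A) (n : ℕ) :
    (A n).natDegree ≤ n := by
  induction n with
  | zero => exact (Polynomial.derivative_eq_zero.mp hA.1).le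
  | succ n ih =>
    have h1 := Polynomial.natDegree_derivative (A (n + 1))
    have h2 := Polynomial.natDegree_smul_le ((n : ℝ) + 1) (A n)
    rw [← hA.2 n] at h2
    omega

theorem eq_of_derivative_eq_of_eval_zero_eq {p q : Polynomial ℝ}
    (hd : p.derivative = q.derivative) (h0 : p.eval 0 = q.eval 0) : p = q := by
  have h : (p - q).derivative = 0 := by simp [hd]
  have h1 := Polynomial.eq_C_of_derivative_eq_zero h
  rw [Polynomial.coeff_zero_eq_eval_zero, Polynomial.eval_sub, h0, sub_self, map_zero] at h1
  exact sub_eq_zero.mp h1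

/-- A weak Appell sequence is determined by its values at zero. -/
theorem IsWeakAppell.ext {A B : ℕ → Polynomial ℝ} (hA : IsWeakAppell A) (hB : IsWeakAppell B)
    (h : ∀ n, (A n).eval 0 = (B n).eval 0) : A = B := by
  funext n
  induction n with
  | zero => exact eq_of_derivative_eq_of_eval_zero_eq (hA.1.trans hB.1.symm) (h 0)
  | succ n ih => exact eq_of_derivative_eq_of_eval_zero_eq (by rw [hA.2, hB.2, ih]) (h _)

theorem fdiffP_smul (k : ℕ) (c : ℝ) (p : Polynomial ℝ) : fdiffP k (c • p) = c • fdiffP k p := by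
  simp only [fdiffP, Polynomial.smul_comp, Finset.smul_sum]
  exact Finset.sum_congr rfl fun j _ => smul_comm _ _ _

theorem fdiffP_sum {ι : Type*} (k : ℕ) (s : Finset ι) (f : ι → Polynomial ℝ) :
    fdiffP k (∑ i ∈ s, f i) = ∑ i ∈ s, fdiffP k (f i) := by
  simp only [fdiffP, Polynomial.sum_comp, Finset.smul_sum]
  exact Finset.sum_comm

theorem derivative_fdiffP (k : ℕ) (p : Polynomial ℝ) :
    (fdiffP k p).derivative = fdiffP k p.derivative := by
  simp [fdiffP, Polynomial.derivative_comp]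

theorem fdiffP_eq_zero_of_natDegree_lt {k : ℕ} {p : Polynomial ℝ} (h : p.natDegree < k) :
    fdiffP k p = 0 := by
  refine Polynomial.funext fun x => ?_
  have h1 := congrFun (Polynomial.fwdDiff_iter_eq_zero_of_degree_lt h) x
  rw [fwdDiff_iter_eq_sum_shift] at h1
  simpa [fdiffP, Polynomial.eval_finsetSum, mul_comm] using h1

theorem IsWeakAppell.LP_eq_sum {A : ℕ → Polynomial ℝ} (hA : IsWeakAppell A) (u : ℕ → ℝ)
    {n N : ℕ} (h : n ≤ N) :
    LP u A n = ∑ k ∈ Finset.range (N + 1), (u k / (k.factorial : ℝ)) • fdiffP k (A n) := by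
  refine Finset.sum_subset (Finset.range_mono (by omega)) fun k _ hk => ?_
  have := hA.natDegree_le n
  rw [Finset.mem_range] at hk
  rw [fdiffP_eq_zero_of_natDegree_lt (by omega), smul_zero]

theorem IsWeakAppell.LP {A : ℕ → Polynomial ℝ} (hA : IsWeakAppell A) (u : ℕ → ℝ) :
    IsWeakAppell (LP u A) := by
  constructor
  · simp [_root_.LP, hA.1, fdiffP]
  · intro n
    rw [hA.LP_eq_sum u n.le_succ]
    simp only [_root_.LP, Polynomial.derivative_sum, Polynomial.derivative_smul,
      derivative_fdiffP, hA.2, fdiffP_smul, Finset.smul_sum]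
    exact Finset.sum_congr rfl fun j _ => smul_comm _ _ _

theorem IsWeakAppell.aconv {C : ℕ → Polynomial ℝ} (hC : IsWeakAppell C) (A : ℕ → Polynomial ℝ) :
    IsWeakAppell (aconv A C) := by
  constructor
  · simp [_root_.aconv, hC.1]
  · intro n
    simp only [_root_.aconv, Polynomial.derivative_sum, Polynomial.derivative_smul]
    rw [Finset.sum_range_succ, Nat.sub_self, hC.1, smul_zero, add_zero, Finset.smul_sum]
    refine Finset.sum_congr rfl fun k hk => ?_
    have hk' : k ≤ n := Nat.lt_succ_iff.mp (Finset.mem_range.mp hk)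
    have h := congrArg (Nat.cast : ℕ → ℝ) (Nat.choose_mul_succ_eq n k)
    rw [Nat.succ_sub hk', Nat.succ_eq_add_one] at h
    rw [Nat.succ_sub hk', Nat.succ_eq_add_one, hC.2, smul_smul, smul_smul]
    push_cast at h ⊢
    congr 1
    linear_combination -(A k).eval 0 * h

theorem aconv_comm {A C : ℕ → Polynomial ℝ} (hA : IsWeakAppell A) (hC : IsWeakAppell C) :
    aconv A C = aconv C A := by
  refine (hC.aconv A).ext (hA.aconv C) fun n => ?_
  simp only [aconv, Polynomial.eval_finsetSum, Polynomial.eval_smul, smul_eq_mul]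
  rw [← Finset.sum_range_reflect]
  refine Finset.sum_congr rfl fun k hk => ?_
  have hk' : k ≤ n := Nat.lt_succ_iff.mp (Finset.mem_range.mp hk)
  rw [Nat.add_sub_cancel, Nat.choose_symm hk', Nat.sub_sub_self hk']
  ring

theorem LP_aconv_right (u : ℕ → ℝ) (A : ℕ → Polynomial ℝ) {C : ℕ → Polynomial ℝ}
    (hC : IsWeakAppell C) : LP u (aconv A C) = aconv A (LP u C) := by
  funext n
  have h : aconv A (LP u C) n = ∑ i ∈ Finset.range (n + 1), ((n.choose i : ℝ) * (A i).eval 0) •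
      ∑ k ∈ Finset.range (n + 1), (u k / (k.factorial : ℝ)) • fdiffP k (C (n - i)) :=
    Finset.sum_congr rfl fun i _ => by rw [hC.LP_eq_sum u (Nat.sub_le n i)]
  rw [h]
  simp only [LP, aconv, fdiffP_sum, fdiffP_smul, Finset.smul_sum]
  rw [Finset.sum_comm]
  exact Finset.sum_congr rfl fun i _ => Finset.sum_congr rfl fun k _ => smul_comm _ _ _

theorem LP_aconv_left (u : ℕ → ℝ) {A C : ℕ → Polynomial ℝ} (hA : IsWeakAppell A)
    (hC : IsWeakAppell C) : LP u (aconv A C) = aconv (LP u A) C := by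
  rw [aconv_comm hA hC, LP_aconv_right u C hA, aconv_comm hC (hA.LP u)]

/-- `L_u` is a multiplier for the binomial convolution of Appell sequences. -/
theorem LP_multiplier (u : ℕ → ℝ) (hu0 : u 0 ≠ 0) (A C : ℕ → Polynomial ℝ)
    (hA : IsAppell A) (hC : IsAppell C) (n : ℕ) (x : ℝ) :
    (LP u (aconv A C) n).eval x = (aconv (LP u A) C n).eval x ∧
    (LP u (aconv A C) n).eval x = (aconv A (LP u C) n).eval x := by
  exact ⟨by rw [LP_aconv_left u hA.isWeakAppell hC.isWeakAppell],
    by rw [LP_aconv_right u A hC.isWeakAppell]⟩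
end

section
/- Let m ∈ ℕ with m ≥ 1, let x_1, …, x_m be real numbers and x = x_1 + ⋯ + x_m. Then for every n ≥ 0, Σ_{j_1+⋯+j_m=n} (n!/(j_1!⋯j_m!)) B_{j_1}(x_1)⋯B_{j_m}(x_m) = Σ_{k=0}^n [s(m+k,m)/(k!·C(m+k,m))] · Δ^k I_n(x), where B_j denotes the j-th Bernoulli polynomial. -/
open Finset MeasureTheory

/-- The power series `e ^ t - 1` is `t` times a unit. -/
lemma exists_isUnit_exp_sub_one :
    ∃ v : PowerSeries ℝ, IsUnit v ∧ PowerSeries.exp ℝ - 1 = PowerSeries.X * v := by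
  refine ⟨PowerSeries.mk fun n => 1 / ((n + 1).factorial : ℝ), ?_, ?_⟩
  · rw [PowerSeries.isUnit_iff_constantCoeff]
    simp [← PowerSeries.coeff_zero_eq_constantCoeff_apply]
  · ext n
    cases n with
    | zero => simp
    | succ n => simp [PowerSeries.coeff_succ_X_mul, PowerSeries.coeff_exp, PowerSeries.coeff_one]

lemma coeff_exp_sub_one_pow_of_lt {n k : ℕ} (h : n < k) :
    PowerSeries.coeff n ((PowerSeries.exp ℝ - 1) ^ k) = 0 := by
  obtain ⟨v, -, hv⟩ := exists_isUnit_exp_sub_one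
  exact PowerSeries.X_pow_dvd_iff.1 ⟨v ^ k, by rw [hv, mul_pow]⟩ n h

lemma eval_fallingFactorial_natCast (N y : ℕ) :
    (∏ i ∈ Finset.range N, (Polynomial.X - Polynomial.C (i : ℝ))).eval (y : ℝ)
      = (N.factorial : ℝ) * (y.choose N : ℝ) := by
  rw [Polynomial.eval_prod]
  simp only [Polynomial.eval_sub, Polynomial.eval_X, Polynomial.eval_C]
  rw [← descPochhammer_eval_eq_prod_range, descPochhammer_eval_eq_descFactorial,
    Nat.descFactorial_eq_factorial_mul_choose, Nat.cast_mul]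

/-- Comparison of coefficients in `e ^ (y t) = (1 + (e ^ t - 1)) ^ y`. -/
lemma natCast_pow_div_factorial (y n : ℕ) :
    (y : ℝ) ^ n / n.factorial = ∑ N ∈ Finset.range (n + 1),
      (y.choose N : ℝ) * PowerSeries.coeff n ((PowerSeries.exp ℝ - 1) ^ N) := by
  have h := congrArg (PowerSeries.coeff n) (PowerSeries.exp_pow_eq_rescale_exp (A := ℝ) y)
  rw [← sub_add_cancel (PowerSeries.exp ℝ) 1, add_pow, sub_add_cancel] at h
  simp only [one_pow, mul_one, map_sum, PowerSeries.coeff_rescale, PowerSeries.coeff_exp,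
    ← map_natCast (PowerSeries.C (R := ℝ)), PowerSeries.coeff_mul_C] at h
  have e : (y : ℝ) ^ n / n.factorial = (y : ℝ) ^ n * (algebraMap ℚ ℝ) (1 / n.factorial) := by
    simp [div_eq_mul_inv]
  rw [e, ← h]
  trans ∑ N ∈ Finset.range (y + 1 + (n + 1)),
      (y.choose N : ℝ) * PowerSeries.coeff n ((PowerSeries.exp ℝ - 1) ^ N)
  · rw [Finset.sum_congr rfl fun _ _ => mul_comm _ _]
    refine Finset.sum_subset (Finset.range_mono (by lia)) fun N _ hN => ?_
    rw [Nat.choose_eq_zero_of_lt (by simpa using hN)]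
    simp
  · refine (Finset.sum_subset (Finset.range_mono (by lia)) fun N _ hN => ?_).symm
    rw [coeff_exp_sub_one_pow_of_lt (by simpa using hN), mul_zero]

open Polynomial in
lemma monomial_eq_sum_fallingFactorial (n : ℕ) :
    monomial n (1 / (n.factorial : ℝ)) = ∑ N ∈ Finset.range (n + 1),
      C (PowerSeries.coeff n ((PowerSeries.exp ℝ - 1) ^ N) / (N.factorial : ℝ)) *
        ∏ i ∈ Finset.range N, (X - C (i : ℝ)) := by
  refine eq_of_infinite_eval_eq _ _
    ((Set.infinite_range_of_injective (Nat.cast_injective (R := ℝ))).mono ?_)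
  rintro _ ⟨y, rfl⟩
  simp only [Set.mem_ofPred_eq, eval_monomial, eval_finsetSum, eval_mul, eval_C,
    eval_fallingFactorial_natCast]
  rw [one_div_mul_eq_div, natCast_pow_div_factorial]
  refine Finset.sum_congr rfl fun N _ => ?_
  have := Nat.cast_ne_zero (R := ℝ).2 N.factorial_ne_zero
  field_simp

lemma stirling1_eq_zero_of_lt {n k : ℕ} (h : n < k) : stirling1 n k = 0 := by
  refine Polynomial.coeff_eq_zero_of_natDegree_lt ?_
  rwa [Polynomial.natDegree_finsetProd_X_sub_C_eq_card, Finset.card_range]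

lemma sum_stirling1_mul_coeff (m n : ℕ) :
    ∑ N ∈ Finset.range (n + 1),
        stirling1 N m / N.factorial * PowerSeries.coeff n ((PowerSeries.exp ℝ - 1) ^ N)
      = if n = m then 1 / (m.factorial : ℝ) else 0 := by
  have h := congrArg (fun p => Polynomial.coeff p m) (monomial_eq_sum_fallingFactorial n)
  simp only [Polynomial.coeff_monomial, Polynomial.finsetSum_coeff, Polynomial.coeff_C_mul] at h
  have e : (if n = m then 1 / (n.factorial : ℝ) else 0)
      = if n = m then 1 / (m.factorial : ℝ) else 0 := by
    split_ifs with e <;> simp [e]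
  rw [← e, h]
  refine Finset.sum_congr rfl fun N _ => ?_
  rw [stirling1]
  ring

/-- The expansion of `t ^ m` in powers of `e ^ t - 1`, truncated. -/
lemma X_pow_dvd_X_pow_sub_sum_stirling1 (m n : ℕ) :
    (PowerSeries.X : PowerSeries ℝ) ^ (m + (n + 1)) ∣ PowerSeries.X ^ m -
      ∑ k ∈ Finset.range (n + 1),
        PowerSeries.C (stirling1 (m + k) m / ((k.factorial : ℝ) * ((m + k).choose m : ℕ))) *
          (PowerSeries.exp ℝ - 1) ^ (m + k) := by
  rw [PowerSeries.X_pow_dvd_iff]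
  intro d hd
  have hc (k : ℕ) : stirling1 (m + k) m / ((k.factorial : ℝ) * ((m + k).choose m : ℕ))
      = m.factorial * (stirling1 (m + k) m / (m + k).factorial) := by
    have h : ((m + k).factorial : ℝ) = (m + k).choose m * m.factorial * k.factorial := by
      rw [Nat.choose_symm_add]
      exact_mod_cast (Nat.add_choose_mul_factorial_mul_factorial m k).symm
    have h₁ := Nat.cast_ne_zero (R := ℝ).2 m.factorial_ne_zero
    have h₂ := Nat.cast_ne_zero (R := ℝ).2 k.factorial_ne_zero
    have h₃ := Nat.cast_ne_zero (R := ℝ).2 (Nat.choose_pos (Nat.le_add_right m k)).ne'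
    rw [h]
    field_simp
  simp only [map_sub, map_sum, PowerSeries.coeff_C_mul, PowerSeries.coeff_X_pow, hc, mul_assoc]
  rw [← Finset.mul_sum, sub_eq_zero]
  let f (N : ℕ) : ℝ := stirling1 N m / N.factorial *
    PowerSeries.coeff d ((PowerSeries.exp ℝ - 1) ^ N)
  have hf : ∑ k ∈ Finset.range (n + 1), f (m + k) = ∑ N ∈ Finset.range (d + 1), f N := by
    trans ∑ N ∈ Finset.range (m + (n + 1)), f N
    · rw [Finset.sum_range_add f m, right_eq_add]
      refine Finset.sum_eq_zero fun N hN => ?_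
      simp [f, stirling1_eq_zero_of_lt (Finset.mem_range.1 hN)]
    · refine (Finset.sum_subset (Finset.range_mono (by lia)) fun N _ hN => ?_).symm
      simp [f, coeff_exp_sub_one_pow_of_lt (show d < N by simpa using hN)]
  rw [hf, sum_stirling1_mul_coeff]
  have h₁ := Nat.cast_ne_zero (R := ℝ).2 m.factorial_ne_zero
  split_ifs <;> simp [h₁]

lemma prod_rescale_exp {ι : Type*} (s : Finset ι) (xs : ι → ℝ) :
    ∏ i ∈ s, PowerSeries.rescale (xs i) (PowerSeries.exp ℝ)
      = PowerSeries.rescale (∑ i ∈ s, xs i) (PowerSeries.exp ℝ) := by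
  classical
  induction s using Finset.induction_on with
  | empty => simp
  | insert a s ha ih =>
    rw [Finset.prod_insert ha, Finset.sum_insert ha, ih, PowerSeries.exp_mul_exp_eq_exp_add]

/-- The generating function of the forward differences of monomials. -/
lemma factorial_mul_coeff_exp_sub_one_pow_mul (k n : ℕ) (x : ℝ) :
    n.factorial * PowerSeries.coeff n
        ((PowerSeries.exp ℝ - 1) ^ k * PowerSeries.rescale x (PowerSeries.exp ℝ))
      = fdiff k (fun y => y ^ n) x := by
  have h₁ := Nat.cast_ne_zero (R := ℝ).2 n.factorial_ne_zero
  have hC (j : ℕ) : (-1 : PowerSeries ℝ) ^ (k - j) * (k.choose j : PowerSeries ℝ)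
      = PowerSeries.C ((k.choose j : ℝ) * (-1) ^ (k - j)) := by
    simp [mul_comm]
  rw [sub_eq_add_neg, add_pow, Finset.sum_mul, map_sum, Finset.mul_sum, fdiff]
  refine Finset.sum_congr rfl fun j _ => ?_
  rw [mul_assoc (PowerSeries.exp ℝ ^ j), hC, mul_right_comm, PowerSeries.exp_pow_eq_rescale_exp,
    PowerSeries.exp_mul_exp_eq_exp_add, PowerSeries.coeff_mul_C, PowerSeries.coeff_rescale,
    PowerSeries.coeff_exp, add_comm (j : ℝ)]
  simp only [map_div₀, map_one, map_natCast]
  field_simp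

lemma coeff_prod_eq_sum_antidiagonalTuple {R : Type*} [CommSemiring R] (m n : ℕ)
    (f : Fin m → PowerSeries R) :
    PowerSeries.coeff n (∏ i, f i)
      = ∑ j ∈ Finset.Nat.antidiagonalTuple m n, ∏ i, PowerSeries.coeff (j i) (f i) := by
  rw [PowerSeries.coeff_prod]
  refine Finset.sum_equiv Finsupp.equivFunOnFinite (fun j => ?_) fun j _ => rfl
  simp [Finset.mem_finsuppAntidiag, Finset.Nat.mem_antidiagonalTuple]

/-- higher-order convolution identity for Bernoulli polynomials:
`∑_{j₁+⋯+j_m=n} (n!/∏jᵢ!) B_{j₁}(x₁)⋯B_{j_m}(x_m)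
  = ∑_{k=0}^n [s(m+k,m)/(k! C(m+k,m))] Δ^k I_n(x)`. -/
theorem bernoulli_multinomial_convolution (m : ℕ) (hm : 1 ≤ m) (xs : Fin m → ℝ) (x : ℝ)
    (hx : ∑ i, xs i = x) (n : ℕ) :
    ∑ j ∈ Finset.Nat.antidiagonalTuple m n,
        (n.factorial : ℝ) / (∏ i, ((j i).factorial : ℝ)) *
          ∏ i, (Polynomial.aeval (xs i)) (Polynomial.bernoulli (j i))
      = ∑ k ∈ Finset.range (n + 1),
          stirling1 (m + k) m / ((k.factorial : ℝ) * (((m + k).choose m : ℕ) : ℝ)) *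
            fdiff k (fun y => y ^ n) x := by
  set G : Fin m → PowerSeries ℝ := fun i => PowerSeries.mk fun n =>
    Polynomial.aeval (xs i) ((1 / n.factorial : ℚ) • Polynomial.bernoulli n)
  set E := PowerSeries.rescale x (PowerSeries.exp ℝ)
  set a : ℕ → ℝ := fun k => stirling1 (m + k) m / ((k.factorial : ℝ) * ((m + k).choose m : ℕ))
  set S : PowerSeries ℝ :=
    ∑ k ∈ Finset.range (n + 1), PowerSeries.C (a k) * (PowerSeries.exp ℝ - 1) ^ k
  have hG : (∏ i, G i) * (PowerSeries.exp ℝ - 1) ^ m = PowerSeries.X ^ m * E := by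
    have h : ∏ i, (G i * (PowerSeries.exp ℝ - 1))
        = ∏ i, (PowerSeries.X * PowerSeries.rescale (xs i) (PowerSeries.exp ℝ)) :=
      Finset.prod_congr rfl fun i _ => Polynomial.bernoulli_generating_function (xs i)
    simpa [Finset.prod_mul_distrib, prod_rescale_exp, hx] using h
  have hdvd : PowerSeries.X ^ (n + 1) ∣ ∏ i, G i - S * E := by
    obtain ⟨v, hv, huv⟩ := exists_isUnit_exp_sub_one
    rw [← (hv.pow m).dvd_mul_right,
      ← mul_dvd_mul_iff_left (pow_ne_zero m (PowerSeries.X_ne_zero (R := ℝ))), ← pow_add]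
    refine (X_pow_dvd_X_pow_sub_sum_stirling1 m n).trans ⟨E, ?_⟩
    rw [mul_left_comm, ← mul_pow, ← huv, sub_mul, sub_mul, hG]
    simp only [pow_add, S, Finset.sum_mul]
    congr 1
    exact Finset.sum_congr rfl fun k _ => by ring
  have hcoeff := PowerSeries.X_pow_dvd_iff.1 hdvd n n.lt_succ_self
  rw [map_sub, sub_eq_zero, coeff_prod_eq_sum_antidiagonalTuple, Finset.sum_mul, map_sum] at hcoeff
  trans n.factorial * ∑ j ∈ Finset.Nat.antidiagonalTuple m n,
    ∏ i, PowerSeries.coeff (j i) (G i)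
  · rw [Finset.mul_sum]
    refine Finset.sum_congr rfl fun j _ => ?_
    simp only [G, PowerSeries.coeff_mk, map_smul, Rat.smul_def, Finset.prod_mul_distrib]
    simp [div_eq_mul_inv, mul_assoc]
  · rw [hcoeff, Finset.mul_sum]
    refine Finset.sum_congr rfl fun k _ => ?_
    rw [mul_assoc, PowerSeries.coeff_C_mul, mul_left_comm, factorial_mul_coeff_exp_sub_one_pow_mul]
end
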